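/- There exist constants c > 0 and R_0 > 0, depending only on k and d, such that for every nonnegative extremizing sequence (f_n) there are (after passing to a subsequence) positive reals λ_n and measurable sets E_n ⊆ [0, R_0] with μ(E_n) ≥ c such that the rescaled functions g_n(r) = λ_n^{d/p} f_n(λ_n r) satisfy g_n ≥ 1_{E_n} pointwise. -/

import Mathlib

open MeasureTheory Set Filter Topology

noncomputable section

/-- The measure `r^(d-1) dr` on `(0, ∞)`. -/
def mu (d : ℕ) : Measure ℝ :=
  (volume.restrict (Ioi (0:ℝ))).withDensity (fun r => ENNReal.ofReal (r ^ (d - 1)))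

/-- The measure `r^(d-k-1) dr` on `(0, ∞)`. -/
def nu (d k : ℕ) : Measure ℝ :=
  (volume.restrict (Ioi (0:ℝ))).withDensity (fun r => ENNReal.ofReal (r ^ (d - k - 1)))

/-- The one-dimensional model operator for the k-plane transform on radial functions. -/
def T (k : ℕ) (f : ℝ → ℝ) (r : ℝ) : ℝ :=
  ∫ u in Ioi r, f u * (u ^ 2 - r ^ 2) ^ ((k : ℝ) / 2 - 1) * u

/-- `p = (d+1)/(k+1)`. -/
def pExp (d k : ℕ) : ℝ := ((d : ℝ) + 1) / ((k : ℝ) + 1)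

/-- `q = d+1`. -/
def qExp (d : ℕ) : ℝ := (d : ℝ) + 1

/-- `B` is the best constant in the `L^p(μ) → L^q(ν)` inequality for `T`. -/
def IsBestConstant (d k : ℕ) (B : ℝ) : Prop :=
  IsLeast {C : ℝ | 0 ≤ C ∧ ∀ f : ℝ → ℝ, Measurable f → (∀ r, 0 ≤ f r) →
    eLpNorm (T k f) (ENNReal.ofReal (qExp d)) (nu d k) ≤
      ENNReal.ofReal C * eLpNorm f (ENNReal.ofReal (pExp d k)) (mu d)} B

/-- `(f n)` is an extremizing sequence for the inequality. -/
def Extremizing (d k : ℕ) (B : ℝ) (f : ℕ → ℝ → ℝ) : Prop :=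
  (∀ n, Measurable (f n)) ∧ (∀ n r, 0 ≤ f n r) ∧
  (∀ n, eLpNorm (f n) (ENNReal.ofReal (pExp d k)) (mu d) = 1) ∧
  Tendsto (fun n => (eLpNorm (T k (f n)) (ENNReal.ofReal (qExp d)) (nu d k)).toReal)
    atTop (𝓝 B)

open scoped ENNReal

/-- A variant of the Young convolution inequality in which part of the norm of `F` is replaced by a
uniform bound on the convolution of lower powers. -/
theorem lintegral_convolution_rpow_le {p q α : ℝ} (hp : 1 < p) (hpq : p < q) (hα : 0 < α)
    (hαq : α < q) {F K : ℝ → ℝ≥0∞} (hF : Measurable F) (hK : Measurable K) {m : ℝ≥0∞}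
    (hm : ∀ x, ∫⁻ y, F y ^ ((q - p) / (q - 1)) * K (x - y) ^ ((q - α) / (q - 1)) ≤ m) :
    ∫⁻ x, (∫⁻ y, F y * K (x - y)) ^ q ≤
      m ^ (q - 1) * ((∫⁻ z, K z ^ α) * ∫⁻ y, F y ^ p) := by
  have hq : 1 < q := hp.trans hpq
  have hq0 : 0 < q := by linarith
  have hq1 : 0 < q - 1 := by linarith
  have hconj : q.HolderConjugate (q / (q - 1)) := Real.HolderConjugate.conjExponent hq
  have hpt : ∀ x, (∫⁻ y, F y * K (x - y)) ^ q ≤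
      m ^ (q - 1) * ∫⁻ y, F y ^ p * K (x - y) ^ α := by
    intro x
    have hKx : Measurable fun y => K (x - y) := hK.comp (measurable_const.sub measurable_id)
    have hsplit : ∀ y, F y * K (x - y) = (F y ^ p * K (x - y) ^ α) ^ (1 / q) *
        (F y ^ ((q - p) / (q - 1)) * K (x - y) ^ ((q - α) / (q - 1))) ^ ((q - 1) / q) := by
      intro y
      have key : ∀ (a : ℝ≥0∞) (s : ℝ), 0 < s → s < q →
          (a ^ s) ^ (1 / q) * (a ^ ((q - s) / (q - 1))) ^ ((q - 1) / q) = a := by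
        intro a s hs hsq
        have hsq' : 0 < q - s := by linarith
        rw [← ENNReal.rpow_mul, ← ENNReal.rpow_mul, ← ENNReal.rpow_add_of_nonneg _ _
          (by positivity) (by positivity)]
        convert ENNReal.rpow_one a using 2
        field_simp
        ring
      rw [ENNReal.mul_rpow_of_nonneg _ _ (by positivity),
        ENNReal.mul_rpow_of_nonneg _ _ (by positivity), mul_mul_mul_comm,
        key _ p (by linarith) hpq, key _ α hα hαq]
    have hH := ENNReal.lintegral_mul_le_Lp_mul_Lq volume hconj
      (f := fun y => (F y ^ p * K (x - y) ^ α) ^ (1 / q))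
      (g := fun y => (F y ^ ((q - p) / (q - 1)) * K (x - y) ^ ((q - α) / (q - 1))) ^ ((q - 1) / q))
      (by fun_prop) (by fun_prop)
    simp only [Pi.mul_apply, ← hsplit, ← ENNReal.rpow_mul] at hH
    have e1 : 1 / q * q = 1 := by field_simp
    have e2 : (q - 1) / q * (q / (q - 1)) = 1 := by field_simp
    simp only [e1, e2, ENNReal.rpow_one] at hH
    calc (∫⁻ y, F y * K (x - y)) ^ q
        ≤ ((∫⁻ y, F y ^ p * K (x - y) ^ α) ^ (1 / q) * m ^ (1 / (q / (q - 1)))) ^ q := by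
          refine ENNReal.rpow_le_rpow (hH.trans ?_) hq0.le
          gcongr
          exact hm x
      _ = m ^ (q - 1) * ∫⁻ y, F y ^ p * K (x - y) ^ α := by
          rw [ENNReal.mul_rpow_of_nonneg _ _ hq0.le, ← ENNReal.rpow_mul, ← ENNReal.rpow_mul, e1,
            ENNReal.rpow_one, mul_comm]
          congr 2
          field_simp
  calc ∫⁻ x, (∫⁻ y, F y * K (x - y)) ^ q
      ≤ ∫⁻ x, m ^ (q - 1) * ∫⁻ y, F y ^ p * K (x - y) ^ α := lintegral_mono hpt
    _ = m ^ (q - 1) * ∫⁻ x, ∫⁻ y, F y ^ p * K (x - y) ^ α := by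
        refine lintegral_const_mul _ (Measurable.lintegral_prod_right ?_)
        fun_prop
    _ = m ^ (q - 1) * ∫⁻ y, ∫⁻ x, F y ^ p * K (x - y) ^ α := by
        rw [lintegral_lintegral_swap]
        exact Measurable.aemeasurable (by fun_prop)
    _ = m ^ (q - 1) * ∫⁻ y, F y ^ p * ∫⁻ z, K z ^ α := by
        congr 2 with y
        rw [lintegral_const_mul _ (by fun_prop),
          lintegral_sub_right_eq_self (fun z => K z ^ α) y]
    _ = m ^ (q - 1) * ((∫⁻ z, K z ^ α) * ∫⁻ y, F y ^ p) := by
        rw [lintegral_mul_const _ (by fun_prop), mul_comm (∫⁻ z, K z ^ α)]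

theorem exists_setLIntegral_compl_closedBall_lt {h : ℝ → ℝ≥0∞} (hfin : ∫⁻ z, h z ≠ ∞)
    {ε : ℝ≥0∞} (hε : 0 < ε) :
    ∃ L : ℝ, ∫⁻ z in (Metric.closedBall 0 L)ᶜ, h z < ε := by
  have : IsFiniteMeasure (volume.withDensity h) := isFiniteMeasure_withDensity hfin
  have ht := tendsto_measure_compl_closedBall_of_isTightMeasureSet
    (isTightMeasureSet_singleton (μ := volume.withDensity h)) 0
  simp only [mem_singleton_iff, iSup_iSup_eq_left] at ht
  obtain ⟨L, hL⟩ := (ht.eventually_lt_const hε).exists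
  exact ⟨L, by rwa [withDensity_apply _ Metric.isClosed_closedBall.measurableSet.compl] at hL⟩

theorem setLIntegral_rpow_mul_le {p t σ β : ℝ} (ht : 0 < t) (hp : 0 < p)
    (hσ : (p / t).HolderConjugate σ) {F K : ℝ → ℝ≥0∞} (hF : Measurable F) (hK : Measurable K)
    (hF1 : ∫⁻ y, F y ^ p ≤ 1) (x : ℝ) (S : Set ℝ) :
    ∫⁻ y in S, F y ^ t * K (x - y) ^ β ≤ (∫⁻ y in S, K (x - y) ^ (β * σ)) ^ (1 / σ) := by
  have hKx : Measurable fun y => K (x - y) := hK.comp (measurable_const.sub measurable_id)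
  refine (ENNReal.lintegral_mul_le_Lp_mul_Lq (volume.restrict S) hσ (f := fun y => F y ^ t)
    (g := fun y => K (x - y) ^ β) (by fun_prop) (by fun_prop)).trans ?_
  simp only [← ENNReal.rpow_mul]
  rw [mul_div_cancel₀ _ ht.ne']
  refine (mul_le_mul_left ?_ _).trans_eq (one_mul _)
  exact ENNReal.rpow_le_one ((setLIntegral_le_lintegral _ _).trans hF1) (by positivity)

theorem exists_pos_ofReal_rpow_mul_lt {s : ℝ} (hs : 0 < s) {C ε : ℝ≥0∞} (hC : C ≠ ∞)
    (hε : 0 < ε) : ∃ δ : ℝ, 0 < δ ∧ ENNReal.ofReal δ ^ s * C < ε := by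
  have hpow : Tendsto (fun δ : ℝ => ENNReal.ofReal δ ^ s) (𝓝[>] 0) (𝓝 0) := by
    have := ((ENNReal.continuous_rpow_const (y := s)).comp
      ENNReal.continuous_ofReal).tendsto (0 : ℝ)
    simp only [Function.comp_apply, ENNReal.ofReal_zero, ENNReal.zero_rpow_of_pos hs] at this
    exact this.mono_left nhdsWithin_le_nhds
  have hmul : Tendsto (fun δ : ℝ => ENNReal.ofReal δ ^ s * C) (𝓝[>] 0) (𝓝 0) := by
    simpa using ENNReal.Tendsto.mul_const hpow (Or.inr hC)
  obtain ⟨δ, hlt, hδ⟩ := ((hmul.eventually_lt_const hε).and self_mem_nhdsWithin).exists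
  exact ⟨δ, hδ, hlt⟩

/-- A function of norm at most one whose convolution with `K` is not small exceeds a fixed height
on a non-negligible part of some interval of fixed length. -/
theorem exists_levelSet_of_le_lintegral_convolution {p q α σ : ℝ} (hp : 1 < p) (hpq : p < q)
    (hα : 0 < α) (hαq : α < q) (hσ : (p / ((q - p) / (q - 1))).HolderConjugate σ)
    {K : ℝ → ℝ≥0∞} (hK : Measurable K) (hKα : ∫⁻ z, K z ^ α ≠ ∞)
    (hKβ : ∫⁻ z, K z ^ ((q - α) / (q - 1)) ≠ ∞)
    (hKσ : ∫⁻ z, K z ^ ((q - α) / (q - 1) * σ) ≠ ∞) {ε : ℝ≥0∞} (hε : 0 < ε) :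
    ∃ η : ℝ, 0 < η ∧ ∃ c : ℝ, 0 < c ∧ ∃ L : ℝ, ∀ F : ℝ → ℝ≥0∞, Measurable F →
      ∫⁻ y, F y ^ p ≤ 1 → ε ≤ ∫⁻ x, (∫⁻ y, F y * K (x - y)) ^ q →
      ∃ x, ENNReal.ofReal c ≤ volume (Metric.closedBall x L ∩ {y | ENNReal.ofReal η ≤ F y}) := by
  have hq1 : 0 < q - 1 := by linarith
  set t := (q - p) / (q - 1) with ht_def
  set β := (q - α) / (q - 1) with hβ_def
  have ht : 0 < t := div_pos (by linarith) hq1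
  have hβ : 0 < β := div_pos (by linarith) hq1
  have hσ0 : 0 < σ := hσ.symm.pos
  obtain ⟨δ, hδ0, hδ⟩ := exists_pos_ofReal_rpow_mul_lt hq1 hKα hε
  obtain ⟨η, hη0, hη⟩ :=
    exists_pos_ofReal_rpow_mul_lt ht hKβ (ENNReal.ofReal_pos.2 (half_pos hδ0))
  have hτ : 0 < ENNReal.ofReal ((δ / 2) ^ σ / 2) := ENNReal.ofReal_pos.2 (by positivity)
  obtain ⟨L, hL⟩ := exists_setLIntegral_compl_closedBall_lt hKσ hτ
  obtain ⟨c', hc'0, hc'⟩ := exists_pos_setLIntegral_lt_of_measure_lt hKσ hτ.ne'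
  obtain ⟨c, hc0, hcc'⟩ : ∃ c : ℝ, 0 < c ∧ ENNReal.ofReal c ≤ c' := by
    obtain ⟨c, -, h1, h2⟩ := ENNReal.lt_iff_exists_real_btwn.1 hc'0
    exact ⟨c, ENNReal.ofReal_pos.1 h1, h2.le⟩
  refine ⟨η, hη0, c, hc0, L, fun F hF hF1 hεF => ?_⟩
  by_contra! hcon
  refine (lt_of_le_of_lt ?_ hδ).not_ge hεF
  refine (lintegral_convolution_rpow_le hp hpq hα hαq hF hK (m := ENNReal.ofReal δ) ?_).trans ?_
  · intro x
    rw [← ht_def, ← hβ_def]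
    have hKx : Measurable fun y => K (x - y) := hK.comp (measurable_const.sub measurable_id)
    set A := Metric.closedBall x L ∩ {y | ENNReal.ofReal η ≤ F y} with hA
    set S := (Metric.closedBall x L)ᶜ ∪ A with hS
    have hcover : (univ : Set ℝ) ⊆ {y | F y < ENNReal.ofReal η} ∪ S := by
      intro y _
      by_cases h1 : F y < ENNReal.ofReal η
      · exact Or.inl h1
      · by_cases h2 : y ∈ Metric.closedBall x L
        · exact Or.inr (Or.inr ⟨h2, not_lt.1 h1⟩)
        · exact Or.inr (Or.inl h2)
    have hreflect : ∀ U : Set ℝ, ∫⁻ y in U, K (x - y) ^ (β * σ) =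
        ∫⁻ z in (fun y => x - y) ⁻¹' U, K z ^ (β * σ) := by
      intro U
      have := (Measure.measurePreserving_sub_left volume x).setLIntegral_comp_preimage_emb
        (MeasurableEquiv.subLeft x).measurableEmbedding (fun z => K z ^ (β * σ))
        ((fun y => x - y) ⁻¹' U)
      rw [← this, ← preimage_comp]
      congr 2
      ext; simp
    have hsmall : ∫⁻ y in S, K (x - y) ^ (β * σ) ≤ ENNReal.ofReal ((δ / 2) ^ σ) := by
      refine (lintegral_union_le _ _ _).trans ?_
      rw [← add_halves ((δ / 2) ^ σ), ENNReal.ofReal_add (by positivity) (by positivity)]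
      refine add_le_add ?_ ?_
      · rw [hreflect]
        convert hL.le using 4
        ext z
        simp
      · rw [hreflect]
        refine (hc' _ ?_).le
        rw [(Measure.measurePreserving_sub_left volume x).measure_preimage_emb
          (MeasurableEquiv.subLeft x).measurableEmbedding]
        exact (hcon x).trans_le hcc'
    calc ∫⁻ y, F y ^ t * K (x - y) ^ β
        ≤ (∫⁻ y in {y | F y < ENNReal.ofReal η}, F y ^ t * K (x - y) ^ β) +
          ∫⁻ y in S, F y ^ t * K (x - y) ^ β := by
          rw [← setLIntegral_univ]
          exact (lintegral_mono_set hcover).trans (lintegral_union_le _ _ _)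
      _ ≤ ENNReal.ofReal (δ / 2) + ENNReal.ofReal (δ / 2) := by
          refine add_le_add ?_ ?_
          · refine le_trans ?_ hη.le
            rw [← lintegral_sub_left_eq_self (fun z => K z ^ β) x,
              ← lintegral_const_mul _ (by fun_prop)]
            refine (setLIntegral_mono (by fun_prop) fun y hy => ?_).trans
              (setLIntegral_le_lintegral {y | F y < ENNReal.ofReal η} _)
            gcongr
            exact le_of_lt hy
          · refine (setLIntegral_rpow_mul_le ht (by linarith) hσ hF hK hF1 x S).trans ?_
            refine (ENNReal.rpow_le_rpow hsmall (by positivity)).trans_eq ?_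
            rw [← ENNReal.ofReal_rpow_of_pos (by positivity), ← ENNReal.rpow_mul,
              mul_one_div_cancel hσ0.ne', ENNReal.rpow_one]
      _ = ENNReal.ofReal δ := by
          rw [← ENNReal.ofReal_add (by positivity) (by positivity), add_halves]
  · gcongr
    exact (mul_le_mul_right hF1 _).trans_eq (mul_one _)

theorem lintegral_Ioi_eq_lintegral_exp {b : ℝ} (hb : 0 < b) (g : ℝ → ℝ≥0∞) :
    ∫⁻ r in Ioi (0 : ℝ), g r =
      ∫⁻ y, ENNReal.ofReal (b * Real.exp (b * y)) * g (Real.exp (b * y)) := by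
  have himage : (fun y => Real.exp (b * y)) '' univ = Ioi 0 := by
    ext r
    simp only [image_univ, mem_range, mem_Ioi]
    refine ⟨fun ⟨y, hy⟩ => hy ▸ Real.exp_pos _, fun hr => ⟨Real.log r / b, ?_⟩⟩
    rw [mul_div_cancel₀ _ hb.ne', Real.exp_log hr]
  have := lintegral_image_eq_lintegral_abs_deriv_mul (f := fun y => Real.exp (b * y))
    (f' := fun y => b * Real.exp (b * y)) (s := univ) MeasurableSet.univ
    (fun y _ => by
      simpa [mul_comm] using ((hasDerivAt_id y).const_mul b).exp)
    (fun x _ y _ h => mul_left_cancel₀ hb.ne' (Real.exp_injective h)) g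
  rw [himage, setLIntegral_univ] at this
  rw [this]
  refine lintegral_congr fun y => ?_
  rw [abs_of_pos (by positivity)]

theorem lintegral_withDensity_pow (n : ℕ) (g : ℝ → ℝ≥0∞) :
    ∫⁻ r, g r ∂((volume.restrict (Ioi (0 : ℝ))).withDensity fun r => ENNReal.ofReal (r ^ n)) =
      ∫⁻ y, ENNReal.ofReal (Real.exp (((n : ℝ) + 1) * y)) * g (Real.exp y) := by
  rw [lintegral_withDensity_eq_lintegral_mul_non_measurable _ (by fun_prop)
    (ae_of_all _ fun _ => ENNReal.ofReal_lt_top), lintegral_Ioi_eq_lintegral_exp one_pos]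
  refine lintegral_congr fun y => ?_
  simp only [one_mul, Pi.mul_apply]
  rw [← mul_assoc, ← ENNReal.ofReal_mul (Real.exp_nonneg _), ← Real.exp_nat_mul, ← Real.exp_add]
  congr 3
  ring

/-- The convolution kernel of `T` in logarithmic coordinates. -/
def logKernel (a e : ℝ) : ℝ → ℝ≥0∞ :=
  (Iio 0).indicator fun z => ENNReal.ofReal (Real.exp (a * z) * (1 - Real.exp (2 * z)) ^ e)

theorem measurable_logKernel (a e : ℝ) : Measurable (logKernel a e) :=
  Measurable.indicator (by fun_prop) measurableSet_Iio

theorem lintegral_logKernel_rpow_ne_top {a e γ : ℝ} (ha : 0 < a) (hγ : 0 < γ) (he : -1 < e * γ) :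
    ∫⁻ z, logKernel a e z ^ γ ≠ ∞ := by
  have hu : 0 < a * γ / 2 := by positivity
  have hv : 0 < e * γ + 1 := by linarith
  have hbeta := ProbabilityTheory.beta_pos hu hv
  have hle : ∀ z, logKernel a e z ^ γ ≤
      ENNReal.ofReal (ProbabilityTheory.beta (a * γ / 2) (e * γ + 1)) *
      (ENNReal.ofReal (2 * Real.exp (2 * z)) *
        ProbabilityTheory.betaPDF (a * γ / 2) (e * γ + 1) (Real.exp (2 * z))) := by
    intro z
    by_cases hz : z < 0
    · have h1 : Real.exp (2 * z) < 1 := Real.exp_lt_one_iff.2 (by linarith)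
      have h2 : 0 < 1 - Real.exp (2 * z) := by linarith
      rw [logKernel, indicator_of_mem (mem_Iio.2 hz),
        ProbabilityTheory.betaPDF_of_pos_lt_one (Real.exp_pos _) h1,
        ENNReal.ofReal_rpow_of_pos (by positivity), ← ENNReal.ofReal_mul (by positivity),
        ← ENNReal.ofReal_mul (by positivity)]
      refine ENNReal.ofReal_le_ofReal ?_
      rw [Real.mul_rpow (by positivity) (by positivity), ← Real.exp_mul, ← Real.rpow_mul h2.le,
        ← Real.exp_mul, add_sub_cancel_right]
      have h3 : Real.exp (a * z * γ) = Real.exp (2 * z) * Real.exp (2 * z * (a * γ / 2 - 1)) := by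
        rw [← Real.exp_add]
        congr 1
        ring
      rw [h3]
      have h4 : 0 ≤ Real.exp (2 * z) * Real.exp (2 * z * (a * γ / 2 - 1)) *
        (1 - Real.exp (2 * z)) ^ (e * γ) := by positivity
      generalize ProbabilityTheory.beta (a * γ / 2) (e * γ + 1) = b at hbeta ⊢
      have h5 : b * (1 / b) = 1 := mul_one_div_cancel hbeta.ne'
      linear_combination h4 - 2 * (Real.exp (2 * z) * Real.exp (2 * z * (a * γ / 2 - 1)) *
        (1 - Real.exp (2 * z)) ^ (e * γ)) * h5
    · rw [logKernel, indicator_of_notMem (by simpa using hz), ENNReal.zero_rpow_of_pos hγ]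
      exact zero_le
  refine ((lintegral_mono hle).trans_lt ?_).ne
  rw [lintegral_const_mul' _ _ ENNReal.ofReal_ne_top, ← lintegral_Ioi_eq_lintegral_exp two_pos]
  refine ENNReal.mul_lt_top ENNReal.ofReal_lt_top ?_
  refine (setLIntegral_le_lintegral _ _).trans_lt ?_
  rw [ProbabilityTheory.lintegral_betaPDF_eq_one hu hv]
  exact ENNReal.one_lt_top

/-- The function `f` in logarithmic coordinates, with the weight `s` that normalizes its norm. -/
def logTransform (s : ℝ) (f : ℝ → ℝ) (y : ℝ) : ℝ≥0∞ :=
  ENNReal.ofReal (Real.exp (s * y) * f (Real.exp y))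

theorem measurable_logTransform (s : ℝ) {f : ℝ → ℝ} (hf : Measurable f) :
    Measurable (logTransform s f) := by
  unfold logTransform
  fun_prop

theorem enorm_T_exp_le {d k : ℕ} {f : ℝ → ℝ} (hf : ∀ r, 0 ≤ f r) (x : ℝ) :
    ENNReal.ofReal (Real.exp (((d : ℝ) - k) / (d + 1) * x)) * ‖T k f (Real.exp x)‖ₑ ≤
      ∫⁻ y, logTransform (d / pExp d k) f y *
        logKernel (((d : ℝ) - k) / (d + 1)) ((k : ℝ) / 2 - 1) (x - y) := by
  have hT : ‖T k f (Real.exp x)‖ₑ ≤ ∫⁻ r in Ioi (0 : ℝ), (Ioi (Real.exp x)).indicator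
      (fun u => ENNReal.ofReal (f u * (u ^ 2 - Real.exp x ^ 2) ^ ((k : ℝ) / 2 - 1) * u)) r := by
    refine (enorm_integral_le_lintegral_enorm _).trans_eq ?_
    rw [setLIntegral_indicator measurableSet_Ioi,
      inter_eq_left.2 (Ioi_subset_Ioi (Real.exp_pos x).le)]
    refine setLIntegral_congr_fun measurableSet_Ioi fun u hu => ?_
    have hxu : Real.exp x < u := hu
    have hx := Real.exp_pos x
    have hu0 : 0 < u := hx.trans hxu
    have h1 : 0 ≤ u ^ 2 - Real.exp x ^ 2 := by nlinarith
    have := hf u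
    exact Real.enorm_of_nonneg (by positivity)
  refine (mul_le_mul_right hT _).trans_eq ?_
  rw [lintegral_Ioi_eq_lintegral_exp one_pos, ← lintegral_const_mul' _ _ ENNReal.ofReal_ne_top]
  refine lintegral_congr fun y => ?_
  simp only [one_mul]
  by_cases hxy : x < y
  · have h1 : 0 < 1 - Real.exp (2 * (x - y)) := by
      have := (Real.exp_lt_one_iff (x := 2 * (x - y))).2 (by linarith)
      linarith
    rw [indicator_of_mem (mem_Ioi.2 (Real.exp_lt_exp.2 hxy)), logKernel,
      indicator_of_mem (by simpa using hxy), logTransform, ← ENNReal.ofReal_mul (by positivity),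
      ← ENNReal.ofReal_mul (by positivity),
      ← ENNReal.ofReal_mul (mul_nonneg (by positivity) (hf _))]
    congr 1
    have h2 : Real.exp y ^ 2 - Real.exp x ^ 2 =
        Real.exp (2 * y) * (1 - Real.exp (2 * (x - y))) := by
      rw [← Real.exp_nat_mul, ← Real.exp_nat_mul, mul_sub, ← Real.exp_add]
      push_cast
      ring_nf
    rw [h2, Real.mul_rpow (by positivity) h1.le, ← Real.exp_mul]
    have h3 : Real.exp (((d : ℝ) - k) / (d + 1) * x) * (Real.exp y *
        (Real.exp (2 * y * ((k : ℝ) / 2 - 1)) * Real.exp y)) =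
        Real.exp (d / pExp d k * y) * Real.exp (((d : ℝ) - k) / (d + 1) * (x - y)) := by
      simp only [← Real.exp_add]
      congr 1
      rw [pExp]
      field_simp
      ring
    linear_combination (f (Real.exp y) * (1 - Real.exp (2 * (x - y))) ^ ((k : ℝ) / 2 - 1)) * h3
  · rw [indicator_of_notMem (by simpa using hxy), logKernel,
      indicator_of_notMem (by simpa using hxy)]
    simp

theorem pExp_pos (d k : ℕ) : 0 < pExp d k := by
  unfold pExp
  positivity

theorem eLpNorm_mu_rpow {d k : ℕ} (hd : 1 ≤ d) {f : ℝ → ℝ} (hf : ∀ r, 0 ≤ f r) :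
    eLpNorm f (ENNReal.ofReal (pExp d k)) (mu d) ^ pExp d k =
      ∫⁻ y, logTransform (d / pExp d k) f y ^ pExp d k := by
  have hp := pExp_pos d k
  rw [eLpNorm_eq_lintegral_rpow_enorm_toReal (ENNReal.ofReal_pos.2 hp).ne' ENNReal.ofReal_ne_top,
    ENNReal.toReal_ofReal hp.le, ← ENNReal.rpow_mul, one_div_mul_cancel hp.ne', ENNReal.rpow_one,
    mu, lintegral_withDensity_pow]
  refine lintegral_congr fun y => ?_
  rw [logTransform, ENNReal.ofReal_mul (Real.exp_nonneg _),
    ENNReal.mul_rpow_of_nonneg _ _ hp.le, Real.enorm_of_nonneg (hf _),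
    ENNReal.ofReal_rpow_of_pos (Real.exp_pos _), ← Real.exp_mul]
  push_cast [Nat.cast_sub hd]
  congr 3
  field_simp
  ring

theorem eLpNorm_T_rpow_le {d k : ℕ} (hkd : k + 1 ≤ d) {f : ℝ → ℝ} (hf : ∀ r, 0 ≤ f r) :
    eLpNorm (T k f) (ENNReal.ofReal (qExp d)) (nu d k) ^ qExp d ≤
      ∫⁻ x, (∫⁻ y, logTransform (d / pExp d k) f y *
        logKernel (((d : ℝ) - k) / (d + 1)) ((k : ℝ) / 2 - 1) (x - y)) ^ qExp d := by
  have hq : 0 < qExp d := by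
    unfold qExp
    positivity
  rw [eLpNorm_eq_lintegral_rpow_enorm_toReal (ENNReal.ofReal_pos.2 hq).ne' ENNReal.ofReal_ne_top,
    ENNReal.toReal_ofReal hq.le, ← ENNReal.rpow_mul, one_div_mul_cancel hq.ne', ENNReal.rpow_one,
    nu, lintegral_withDensity_pow]
  refine lintegral_mono fun x => le_trans (le_of_eq ?_)
    (ENNReal.rpow_le_rpow (enorm_T_exp_le (d := d) hf x) hq.le)
  rw [ENNReal.mul_rpow_of_nonneg _ _ hq.le, ENNReal.ofReal_rpow_of_pos (Real.exp_pos _),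
    ← Real.exp_mul, Nat.sub_sub, Nat.cast_sub hkd]
  congr 3
  rw [qExp]
  push_cast
  field_simp
  ring

theorem le_mu_of_logTransform_levelSet {d : ℕ} (hd : 1 ≤ d) {s η c x L : ℝ} (hs : 0 < s)
    (hη : 0 < η) {f : ℝ → ℝ} (hf : Measurable f)
    (h : ENNReal.ofReal c ≤
      volume (Metric.closedBall x L ∩ {y | ENNReal.ofReal η ≤ logTransform s f y})) :
    ∃ lam : ℝ, 0 < lam ∧ ENNReal.ofReal (Real.exp (-(2 * d * L)) * η ^ (d / s) * c) ≤
      mu d (Icc 0 (η ^ s⁻¹) ∩ {r | 1 ≤ lam ^ s * f (lam * r)}) := by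
  set w := x + L - Real.log η / s with hw
  refine ⟨Real.exp w, Real.exp_pos _, ?_⟩
  set E := Icc 0 (η ^ s⁻¹) ∩ {r | 1 ≤ Real.exp w ^ s * f (Real.exp w * r)} with hE_def
  have hE : MeasurableSet E :=
    measurableSet_Icc.inter (measurableSet_le measurable_const (by fun_prop))
  set A := Metric.closedBall x L ∩ {y | ENNReal.ofReal η ≤ logTransform s f y} with hA_def
  have hA : MeasurableSet A := measurableSet_closedBall.inter
    (measurableSet_le measurable_const (measurable_logTransform s hf))
  have hmaps : ∀ y ∈ A, Real.exp (y - w) ∈ E := by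
    rintro y ⟨hy, hyη⟩
    rw [Metric.mem_closedBall, Real.dist_eq, abs_le] at hy
    refine ⟨⟨(Real.exp_pos _).le, ?_⟩, ?_⟩
    · rw [Real.rpow_def_of_pos hη, Real.exp_le_exp, hw, ← div_eq_mul_inv]
      linarith
    · have hpos : 0 < Real.exp (s * y) * f (Real.exp y) := by
        have := (ENNReal.ofReal_pos.2 hη).trans_le hyη
        exact ENNReal.ofReal_pos.1 this
      have h1 : η ≤ Real.exp (s * y) * f (Real.exp y) :=
        (ENNReal.ofReal_le_ofReal_iff hpos.le).1 hyη
      have hfpos : 0 < f (Real.exp y) := pos_of_mul_pos_right hpos (Real.exp_nonneg _)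
      have h2 : Real.exp (s * y) / η ≤ Real.exp w ^ s := by
        rw [← Real.exp_mul, hw]
        nth_rewrite 1 [← Real.exp_log hη]
        rw [← Real.exp_sub, Real.exp_le_exp, sub_mul, div_mul_cancel₀ _ hs.ne']
        nlinarith
      simp only [mem_ofPred_eq]
      rw [← Real.exp_add, add_sub_cancel]
      calc 1 ≤ Real.exp (s * y) / η * f (Real.exp y) := by
            rw [div_mul_eq_mul_div, one_le_div hη]
            exact h1
        _ ≤ _ := by gcongr
  have hdens : ∀ y ∈ A, Real.exp (-(2 * d * L)) * η ^ (d / s) ≤ Real.exp (d * (y - w)) := by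
    rintro y ⟨hy, -⟩
    rw [Metric.mem_closedBall, Real.dist_eq, abs_le] at hy
    rw [Real.rpow_def_of_pos hη, ← Real.exp_add, Real.exp_le_exp]
    have hd0 : (0 : ℝ) ≤ d := by positivity
    have : (d : ℝ) * (y - w) = d * (y - x - L) + Real.log η * (d / s) := by
      rw [hw]
      ring
    rw [this]
    nlinarith
  calc ENNReal.ofReal (Real.exp (-(2 * d * L)) * η ^ (d / s) * c)
      = ENNReal.ofReal (Real.exp (-(2 * d * L)) * η ^ (d / s)) * ENNReal.ofReal c :=
        ENNReal.ofReal_mul (by positivity)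
    _ ≤ ENNReal.ofReal (Real.exp (-(2 * d * L)) * η ^ (d / s)) * volume A := by gcongr
    _ = ∫⁻ y in A, ENNReal.ofReal (Real.exp (-(2 * d * L)) * η ^ (d / s)) := by
        rw [setLIntegral_const]
    _ ≤ ∫⁻ y in A, ENNReal.ofReal (Real.exp (d * (y - w))) * E.indicator 1 (Real.exp (y - w)) := by
        refine setLIntegral_mono' hA fun y hy => ?_
        rw [indicator_of_mem (hmaps y hy), Pi.one_apply, mul_one]
        exact ENNReal.ofReal_le_ofReal (hdens y hy)
    _ ≤ ∫⁻ y, ENNReal.ofReal (Real.exp (d * (y - w))) * E.indicator 1 (Real.exp (y - w)) :=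
        setLIntegral_le_lintegral _ _
    _ = ∫⁻ y, ENNReal.ofReal (Real.exp (d * y)) * E.indicator 1 (Real.exp y) :=
        lintegral_sub_right_eq_self
          (fun y => ENNReal.ofReal (Real.exp (d * y)) * E.indicator 1 (Real.exp y)) w
    _ = mu d E := by
        rw [← lintegral_indicator_one hE, mu, lintegral_withDensity_pow, Nat.cast_sub hd]
        simp

/-- A function of norm one whose image under `T` has norm at least `b` dominates, after rescaling,
the indicator of a set of fixed measure in a fixed interval. -/
theorem exists_rescaled_levelSet {d k : ℕ} (hk : 1 ≤ k) (hkd : k + 1 ≤ d) {b : ℝ} (hb : 0 < b) :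
    ∃ c : ℝ, 0 < c ∧ ∃ R : ℝ, 0 < R ∧ ∀ f : ℝ → ℝ, Measurable f → (∀ r, 0 ≤ f r) →
      eLpNorm f (ENNReal.ofReal (pExp d k)) (mu d) = 1 →
      ENNReal.ofReal b ≤ eLpNorm (T k f) (ENNReal.ofReal (qExp d)) (nu d k) →
      ∃ lam : ℝ, 0 < lam ∧ ENNReal.ofReal c ≤
        mu d (Icc 0 R ∩ {r | 1 ≤ lam ^ ((d : ℝ) / pExp d k) * f (lam * r)}) := by
  have hk' : (1 : ℝ) ≤ k := by exact_mod_cast hk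
  have hkd' : (k : ℝ) + 1 ≤ d := by exact_mod_cast hkd
  have hdk : (0 : ℝ) < d - k := by linarith
  have hd0 : (0 : ℝ) < d := by linarith
  have hp : 1 < pExp d k := by
    rw [pExp, one_lt_div (by positivity)]
    linarith
  have hpq : pExp d k < qExp d := by
    rw [pExp, qExp, div_lt_iff₀ (by positivity)]
    nlinarith
  have hq1 : qExp d - 1 = d := by simp [qExp]
  have hq : 0 < qExp d := by linarith
  have hσ : (pExp d k / ((qExp d - pExp d k) / (qExp d - 1))).HolderConjugate (d / (d - k)) := by
    have h1 : pExp d k / ((qExp d - pExp d k) / (qExp d - 1)) = d / k := by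
      have : qExp d - pExp d k = (d + 1) * k / (k + 1) := by
        rw [qExp, pExp]
        field_simp
        ring
      rw [this, hq1, pExp]
      field_simp
    rw [h1, Real.holderConjugate_iff]
    refine ⟨(one_lt_div (by linarith)).2 (by linarith), ?_⟩
    field_simp
    ring
  have hα : (3 / 2 : ℝ) < qExp d := by linarith
  have ha : 0 < ((d : ℝ) - k) / (d + 1) := by positivity
  have hβ : 0 < (qExp d - 3 / 2) / (qExp d - 1) := div_pos (by linarith) (by linarith)
  have hβ1 : (qExp d - 3 / 2) / (qExp d - 1) < 1 := by
    rw [div_lt_one (by linarith)]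
    linarith
  have hexp : ∀ γ : ℝ, 0 < γ → (k = 1 → γ < 2) → -1 < ((k : ℝ) / 2 - 1) * γ := by
    intro γ hγ hγ2
    rcases hk.eq_or_lt with rfl | hk2
    · have := hγ2 rfl
      push_cast
      linarith
    · have hk2' : (2 : ℝ) ≤ k := by exact_mod_cast hk2
      have : 0 ≤ ((k : ℝ) / 2 - 1) * γ := mul_nonneg (by linarith) hγ.le
      linarith
  have hfin : ∀ γ : ℝ, 0 < γ → (k = 1 → γ < 2) →
      ∫⁻ z, logKernel (((d : ℝ) - k) / (d + 1)) ((k : ℝ) / 2 - 1) z ^ γ ≠ ∞ :=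
    fun γ hγ hγ2 => lintegral_logKernel_rpow_ne_top ha hγ (hexp γ hγ hγ2)
  obtain ⟨η, hη, c, hc, L, hlevel⟩ := exists_levelSet_of_le_lintegral_convolution hp hpq
    (by norm_num) hα hσ (measurable_logKernel (((d : ℝ) - k) / (d + 1)) ((k : ℝ) / 2 - 1))
    (hfin _ (by norm_num) fun _ => by norm_num) (hfin _ hβ fun _ => by linarith)
    (hfin _ (by positivity) fun h1 => by
      rw [hq1, qExp, h1, Nat.cast_one]
      have : (0 : ℝ) < d - 1 := by linarith
      field_simp
      linarith)
    (ENNReal.ofReal_pos.2 (Real.rpow_pos_of_pos hb (qExp d)))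
  have hs : 0 < (d : ℝ) / pExp d k := by positivity
  refine ⟨Real.exp (-(2 * d * L)) * η ^ (d / (d / pExp d k)) * c, by positivity,
    η ^ ((d : ℝ) / pExp d k)⁻¹, by positivity, fun f hf hf0 hf1 hfb => ?_⟩
  obtain ⟨x, hx⟩ := hlevel (logTransform (d / pExp d k) f) (measurable_logTransform _ hf)
    (by rw [← eLpNorm_mu_rpow (by omega) hf0, hf1, ENNReal.one_rpow])
    (by
      refine le_trans ?_ (eLpNorm_T_rpow_le hkd hf0)
      rw [← ENNReal.ofReal_rpow_of_pos hb]
      gcongr)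
  exact le_mu_of_logTransform_levelSet (by omega) hs hη hf hx

/-- after rescaling, extremizing sequences dominate the indicator of a
set of fixed measure contained in a fixed interval `[0, R₀]`. -/
theorem extremizing_lower_bound_on_compact
    (d k : ℕ) (hd : 2 ≤ d) (hk1 : 1 ≤ k) (hkd : k ≤ d - 1)
    (B : ℝ) (hBpos : 0 < B) (hB : IsBestConstant d k B) :
    ∃ c : ℝ, 0 < c ∧ ∃ R₀ : ℝ, 0 < R₀ ∧
      ∀ f : ℕ → ℝ → ℝ, Extremizing d k B f →
        ∃ σ : ℕ → ℕ, StrictMono σ ∧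
          ∃ lam : ℕ → ℝ, (∀ n, 0 < lam n) ∧
            ∃ E : ℕ → Set ℝ,
              (∀ n, MeasurableSet (E n)) ∧
              (∀ n, E n ⊆ Icc 0 R₀) ∧
              (∀ n, ENNReal.ofReal c ≤ mu d (E n)) ∧
              (∀ n, ∀ r ∈ E n,
                (1 : ℝ) ≤ (lam n) ^ ((d : ℝ) / pExp d k) * f (σ n) (lam n * r)) := by
  obtain ⟨c, hc, R, hR, hlevel⟩ :=
    exists_rescaled_levelSet (d := d) (k := k) hk1 (by omega) (half_pos hBpos)
  refine ⟨c, hc, R, hR, fun f ⟨hf, hf0, hf1, hlim⟩ => ?_⟩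
  obtain ⟨N, hN⟩ := eventually_atTop.1 (hlim.eventually_const_lt (half_lt_self hBpos))
  have hscale := fun n => hlevel (f (n + N)) (hf _) (hf0 _) (hf1 _)
    ((ENNReal.ofReal_le_ofReal (hN (n + N) (by omega)).le).trans ENNReal.ofReal_toReal_le)
  choose lam hlam hmeas using hscale
  refine ⟨fun n => n + N, fun m n h => Nat.add_lt_add_right h N, lam, hlam,
    fun n => Icc 0 R ∩ {r | 1 ≤ lam n ^ ((d : ℝ) / pExp d k) * f (n + N) (lam n * r)},
    fun n => ?_, fun n => inter_subset_left, hmeas, fun n r hr => hr.2⟩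
  have := hf (n + N)
  exact measurableSet_Icc.inter (measurableSet_le measurable_const (by fun_prop))
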